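/- Let 1 < α < 2 and let G be the left Riemann–Liouville Green's kernel on [0,1]. There exist constants C₃ > 0 and h₀ > 0, depending only on α, such that the following holds: for every finite set X = {x₁, …, x_N} ⊂ (0,1) with fill distance h = sup_{x∈[0,1]} min_{1≤j≤N} |x − x_j| ≤ h₀, every f ∈ C¹([0,1]) with f(0) = f(1) = 0 and f′(0) = 0 whose left Riemann–Liouville derivative ₀D_x^α f exists and lies in L²(0,1), and every function of the form s(x) = Σ_{j=1}^{N} c_j G(x, x_j) (c_j ∈ ℝ) satisfying the interpolation conditions s(x_i) = f(x_i) for all i = 1, …, N, one has ‖f − s‖_{L²(0,1)} ≤ C₃ · h^α · ‖₀D_x^α f‖_{L²(0,1)}. -/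

import Mathlib

open MeasureTheory Set intervalIntegral

/-- The left Riemann–Liouville Green's kernel on `[0,1]` for order `α`. -/
noncomputable def rlGreen (α : ℝ) (x z : ℝ) : ℝ :=
  if z ≤ x then (1 / Real.Gamma α) * ((x * (1 - z)) ^ (α - 1) - (x - z) ^ (α - 1))
  else (1 / Real.Gamma α) * (x ^ (α - 1) * (1 - z) ^ (α - 1))

/-- The fractional integral whose second derivative is the left Riemann–Liouville
derivative of order `α ∈ (1,2)`. -/
noncomputable def fracIntL (α : ℝ) (u : ℝ → ℝ) : ℝ → ℝ :=
  fun x => (1 / Real.Gamma (2 - α)) * ∫ t in (0:ℝ)..x, (x - t) ^ (1 - α) * u t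

/-- The fill distance `h = sup_{x ∈ [0,1]} min_{x_j ∈ X} |x - x_j|` of a finite
point set `X` relative to `[0,1]`. -/
noncomputable def fillDist (X : Finset ℝ) : ℝ :=
  ⨆ x : Set.Icc (0:ℝ) 1, ⨅ j : X, |(x : ℝ) - (j : ℝ)|

/-- The truncated power `s₊ ^ r`, equal to `0` for `s ≤ 0`. -/
noncomputable def posPow (r s : ℝ) : ℝ := if 0 < s then s ^ r else 0

lemma posPow_of_pos (r : ℝ) {s : ℝ} (hs : 0 < s) : posPow r s = s ^ r := if_pos hs

lemma posPow_of_nonpos (r : ℝ) {s : ℝ} (hs : s ≤ 0) : posPow r s = 0 := if_neg hs.not_gt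

lemma posPow_nonneg (r s : ℝ) : 0 ≤ posPow r s := by
  unfold posPow; split_ifs <;> positivity

@[fun_prop]
lemma measurable_posPow (r : ℝ) : Measurable (posPow r) :=
  Measurable.ite measurableSet_Ioi (measurable_id.pow_const r) measurable_const

lemma posPow_mul (r : ℝ) {L : ℝ} (hL : 0 < L) (s : ℝ) : posPow r (L * s) = L ^ r * posPow r s := by
  unfold posPow
  by_cases hs : 0 < s
  · rw [if_pos (mul_pos hL hs), if_pos hs, Real.mul_rpow hL.le hs.le]
  · rw [if_neg hs, if_neg (by simpa [hL] using hs), mul_zero]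

lemma posPow_sq (r s : ℝ) : posPow r s ^ 2 = posPow (2 * r) s := by
  unfold posPow
  split_ifs with hs
  · rw [← Real.rpow_natCast, ← Real.rpow_mul hs.le, mul_comm, Nat.cast_two]
  · simp

lemma integrableOn_posPow_Iic {r : ℝ} (hr : -1 < r) (R : ℝ) :
    IntegrableOn (posPow r) (Iic R) := by
  have h1 : posPow r = indicator (Ioi 0) (fun s => s ^ r) := by
    ext s; simp [posPow, indicator]
  rw [h1, IntegrableOn, integrable_indicator_iff measurableSet_Ioi, IntegrableOn,
    Measure.restrict_restrict measurableSet_Ioi, Ioi_inter_Iic]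
  rcases le_or_gt 0 R with hR | hR
  · exact (intervalIntegrable_iff_integrableOn_Ioc_of_le hR).1 (intervalIntegrable_rpow' hr)
  · simp [Ioc_eq_empty_of_le hR.le]

lemma integrable_posPow_mul_one_sub {p q : ℝ} (hp : -1 < p) (hq : -1 < q) :
    Integrable (fun t => posPow p (1 - t) * posPow q t) := by
  have h := Complex.betaIntegral_convergent (u := (q + 1 : ℝ)) (v := (p + 1 : ℝ))
    (by simp; linarith) (by simp; linarith)
  rw [intervalIntegrable_iff_integrableOn_Ioo_of_le zero_le_one] at h
  have h2 : (fun t => posPow p (1 - t) * posPow q t) =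
      indicator (Ioo 0 1) (fun t => posPow p (1 - t) * posPow q t) := by
    ext t
    by_cases ht : t ∈ Ioo (0:ℝ) 1
    · rw [indicator_of_mem ht]
    · rw [indicator_of_notMem ht]
      rw [mem_Ioo, not_and_or] at ht
      rcases ht with ht | ht
      · rw [posPow_of_nonpos q (not_lt.1 ht), mul_zero]
      · rw [posPow_of_nonpos p (by linarith), zero_mul]
  rw [h2, integrable_indicator_iff measurableSet_Ioo]
  refine IntegrableOn.congr_fun h.norm (fun t ht => ?_) measurableSet_Ioo
  have h1t : (1 : ℂ) - t = ((1 - t : ℝ) : ℂ) := by push_cast; rfl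
  simp only [norm_mul]
  rw [h1t, Complex.norm_cpow_eq_rpow_re_of_pos ht.1,
    Complex.norm_cpow_eq_rpow_re_of_pos (by linarith [ht.2]),
    posPow_of_pos q ht.1, posPow_of_pos p (by linarith [ht.2])]
  simp [mul_comm]

/-- Beta-type composition rule for truncated powers. -/
lemma exists_posPow_comp {p q : ℝ} (hp : -1 < p) (hq : -1 < q) :
    ∃ B > (0:ℝ), ∀ x z : ℝ, Integrable (fun t => posPow p (x - t) * posPow q (t - z)) ∧
      ∫ t, posPow p (x - t) * posPow q (t - z) = B * posPow (p + q + 1) (x - z) := by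
  have h0 := integrable_posPow_mul_one_sub hp hq
  refine ⟨∫ t, posPow p (1 - t) * posPow q t, ?_, fun x z => ?_⟩
  · rw [gt_iff_lt, integral_pos_iff_support_of_nonneg
      (fun t => mul_nonneg (posPow_nonneg _ _) (posPow_nonneg _ _)) h0]
    refine lt_of_lt_of_le ?_ (measure_mono (s := Ioo (0:ℝ) 1) fun t ht => ?_)
    · simp
    · rw [Function.mem_support, posPow_of_pos q ht.1, posPow_of_pos p (by linarith [ht.2])]
      have := Real.rpow_pos_of_pos ht.1 q
      have := Real.rpow_pos_of_pos (show 0 < 1 - t by linarith [ht.2]) p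
      positivity
  · rcases le_or_gt x z with hxz | hxz
    · have : (fun t => posPow p (x - t) * posPow q (t - z)) = fun _ => 0 := by
        ext t
        rcases le_or_gt x t with h | h
        · rw [posPow_of_nonpos p (by linarith), zero_mul]
        · rw [posPow_of_nonpos q (by linarith), mul_zero]
      rw [this, posPow_of_nonpos _ (by linarith)]
      simp
    · have hL : 0 < x - z := by linarith
      have hF : (fun t => posPow p (x - t) * posPow q (t - z)) = fun t => (x - z) ^ (p + q) *
          (fun t => posPow p (1 - t) * posPow q t) ((t - z) / (x - z)) := by
        ext t
        have e1 : x - t = (x - z) * (1 - (t - z) / (x - z)) := by field_simp; ring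
        have e2 : t - z = (x - z) * ((t - z) / (x - z)) := by field_simp
        rw [Real.rpow_add hL, mul_mul_mul_comm, ← posPow_mul p hL, ← posPow_mul q hL, ← e1, ← e2]
      have h1 := (h0.comp_div hL.ne').comp_sub_right z
      rw [hF]
      refine ⟨h1.const_mul _, ?_⟩
      rw [MeasureTheory.integral_const_mul,
        integral_sub_right_eq_self
          (fun t => (fun t => posPow p (1 - t) * posPow q t) (t / (x - z))) z,
        Measure.integral_comp_div (fun t => posPow p (1 - t) * posPow q t), posPow_of_pos _ hL,
        Real.rpow_add_one hL.ne', abs_of_pos hL,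
        smul_eq_mul]
      ring

/-- Composition of truncated-power potentials of an absolutely integrable density. -/
lemma posPow_comp_potential {p q r B : ℝ}
    (hB : ∀ x z : ℝ, Integrable (fun t => posPow p (x - t) * posPow q (t - z)) ∧
      ∫ t, posPow p (x - t) * posPow q (t - z) = B * posPow r (x - z))
    {μ : Measure ℝ} [SFinite μ] {u : ℝ → ℝ} (hu : AEStronglyMeasurable u μ) {x : ℝ}
    (hx : Integrable (fun z => posPow r (x - z) * u z) μ) :
    Integrable (fun t => posPow p (x - t) * ∫ z, posPow q (t - z) * u z ∂μ) ∧
    ∫ t, posPow p (x - t) * ∫ z, posPow q (t - z) * u z ∂μ =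
      B * ∫ z, posPow r (x - z) * u z ∂μ := by
  have hm : AEStronglyMeasurable
      (fun w : ℝ × ℝ => posPow p (x - w.1) * posPow q (w.1 - w.2) * u w.2)
      (volume.prod μ) := by
    refine AEStronglyMeasurable.mul ?_ hu.comp_snd
    exact Measurable.aestronglyMeasurable (by fun_prop)
  have hjoint : Integrable
      (fun w : ℝ × ℝ => posPow p (x - w.1) * posPow q (w.1 - w.2) * u w.2)
      (volume.prod μ) := by
    rw [integrable_prod_iff' hm]
    refine ⟨Filter.Eventually.of_forall fun z => (hB x z).1.mul_const (u z), ?_⟩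
    refine (hx.norm.const_mul B).congr (Filter.Eventually.of_forall fun z => ?_)
    simp only [norm_mul]
    rw [MeasureTheory.integral_mul_const]
    simp_rw [Real.norm_of_nonneg (posPow_nonneg _ _)]
    rw [(hB x z).2]; ring
  have hl := hjoint.integral_prod_left
  simp_rw [mul_assoc, MeasureTheory.integral_const_mul] at hl
  refine ⟨hl, ?_⟩
  have := integral_integral_swap
    (f := fun t z => posPow p (x - t) * posPow q (t - z) * u z) hjoint
  simp_rw [mul_assoc, MeasureTheory.integral_const_mul] at this
  rw [this, ← MeasureTheory.integral_const_mul]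
  refine MeasureTheory.integral_congr_ae (Filter.Eventually.of_forall fun z => ?_)
  simp only
  simp_rw [← mul_assoc]
  rw [MeasureTheory.integral_mul_const, (hB x z).2]

/-- Cauchy–Schwarz inequality for real integrals. -/
lemma sq_integral_mul_le {X : Type*} [MeasurableSpace X] {μ : Measure X} {f g : X → ℝ}
    (hfm : AEStronglyMeasurable f μ) (hgm : AEStronglyMeasurable g μ)
    (hf : Integrable (fun x => f x ^ 2) μ) (hg : Integrable (fun x => g x ^ 2) μ) :
    Integrable (fun x => f x * g x) μ ∧
    (∫ x, f x * g x ∂μ) ^ 2 ≤ (∫ x, f x ^ 2 ∂μ) * ∫ x, g x ^ 2 ∂μ := by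
  have hfg : Integrable (fun x => f x * g x) μ := by
    refine (hf.add hg).mono' (hfm.mul hgm) (Filter.Eventually.of_forall fun x => ?_)
    rw [Real.norm_eq_abs, Pi.add_apply, abs_le]
    constructor <;> nlinarith [sq_nonneg (f x + g x), sq_nonneg (f x - g x)]
  refine ⟨hfg, ?_⟩
  have key : ∀ t : ℝ, 0 ≤ (∫ x, f x ^ 2 ∂μ) * (t * t) + (2 * ∫ x, f x * g x ∂μ) * t
      + ∫ x, g x ^ 2 ∂μ := by
    intro t
    have h0 : 0 ≤ ∫ x, (t * f x + g x) ^ 2 ∂μ := integral_nonneg fun x => sq_nonneg _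
    have h1 : ∫ x, (t * f x + g x) ^ 2 ∂μ =
        ∫ x, ((t * t) * f x ^ 2 + (2 * t) * (f x * g x)) + g x ^ 2 ∂μ := by
      congr 1; ext x; ring
    have i1 := hf.const_mul (t * t)
    have i2 := hfg.const_mul (2 * t)
    have i3 : Integrable (fun x => t * t * f x ^ 2 + 2 * t * (f x * g x)) μ := i1.add i2
    rw [h1, integral_add i3 hg, integral_add i1 i2, MeasureTheory.integral_const_mul,
      MeasureTheory.integral_const_mul] at h0
    linarith
  have := discrim_le_zero key
  unfold discrim at this
  nlinarith

lemma abs_rpow_sub_rpow_le {a u v w : ℝ} (ha0 : 0 < a) (ha1 : a < 1) (hw : 0 < w)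
    (hu : w ≤ u) (hv : w ≤ v) : |u ^ (a - 1) - v ^ (a - 1)| ≤ w ^ (a - 2) * |u - v| := by
  have := (convex_Ici w).norm_image_sub_le_of_norm_deriv_le (f := fun s : ℝ => s ^ (a - 1))
    (C := w ^ (a - 2)) (x := v) (y := u) (fun s hs => ?_) (fun s hs => ?_) hv hu
  · simpa [Real.norm_eq_abs] using this
  · have : 0 < s := hw.trans_le hs
    exact (Real.hasDerivAt_rpow_const (Or.inl this.ne')).differentiableAt
  · have h0 : 0 < s := hw.trans_le hs
    rw [(Real.hasDerivAt_rpow_const (Or.inl h0.ne')).deriv, norm_mul, Real.norm_eq_abs,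
      Real.norm_eq_abs, abs_of_nonneg (Real.rpow_nonneg h0.le _), abs_of_neg (by linarith)]
    have h1 : s ^ (a - 1 - 1) ≤ w ^ (a - 2) := by
      rw [show a - 1 - 1 = a - 2 by ring]
      exact Real.rpow_le_rpow_of_nonpos hw hs (by linarith)
    have h2 : 0 ≤ s ^ (a - 1 - 1) := Real.rpow_nonneg h0.le _
    nlinarith

lemma exists_weighted_difference_bound_unit {a : ℝ} (ha0 : 1 / 2 < a) (ha1 : a < 1) :
    ∃ K : ℝ, 0 ≤ K ∧ ∀ η : ℝ, |η| ≤ 1 →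
      Integrable (fun s => (posPow (a - 1) s - posPow (a - 1) (s - η)) ^ 2 *
        (1 + |s|) ^ (2 - a)) ∧
      ∫ s, (posPow (a - 1) s - posPow (a - 1) (s - η)) ^ 2 * (1 + |s|) ^ (2 - a) ≤ K := by
  set P : ℝ → ℝ := indicator (Iic 4) (posPow (2 * (a - 1))) with hP
  set T : ℝ → ℝ := indicator (Ioi 1) (fun s => s ^ (a - 2)) with hT
  have iP : Integrable P := by
    rw [hP, integrable_indicator_iff measurableSet_Iic]
    exact integrableOn_posPow_Iic (by linarith) 4
  have iT : Integrable T := by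
    rw [hT, integrable_indicator_iff measurableSet_Ioi]
    exact integrableOn_Ioi_rpow_of_lt (by linarith) one_pos
  have hP0 : ∀ s, 0 ≤ P s := fun s => indicator_nonneg (fun _ _ => posPow_nonneg _ _) _
  have hT0 : ∀ s, 0 ≤ T s := fun s => indicator_nonneg
    (fun s hs => Real.rpow_nonneg (zero_le_one.trans (le_of_lt hs)) _) _
  have iP0 : 0 ≤ ∫ s, P s := integral_nonneg hP0
  have iT0 : 0 ≤ ∫ s, T s := integral_nonneg hT0
  set c : ℝ := 2 * 4 ^ (2 - a) with hc
  set d : ℝ := 2 ^ (2 - a) with hd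
  have hc0 : 0 ≤ c := by positivity
  have hd0 : 0 ≤ d := by positivity
  refine ⟨c * (∫ s, P s) + c * (∫ s, P s) + d * ∫ s, T s, by positivity, fun η hη => ?_⟩
  obtain ⟨hη1, hη2⟩ := abs_le.1 hη
  have i1 : Integrable (fun s => c * P s) := iP.const_mul c
  have i2 : Integrable (fun s => c * P (s - η)) := (iP.comp_sub_right η).const_mul c
  have i3 : Integrable (fun s => d * T (s - 1)) := (iT.comp_sub_right 1).const_mul d
  have i4 : Integrable (fun s => c * P s + c * P (s - η)) := i1.add i2
  have i5 : Integrable (fun s => c * P s + c * P (s - η) + d * T (s - 1)) := i4.add i3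
  have hle : ∀ s, (posPow (a - 1) s - posPow (a - 1) (s - η)) ^ 2 * (1 + |s|) ^ (2 - a) ≤
      c * P s + c * P (s - η) + d * T (s - 1) := by
    intro s
    have p1 := mul_nonneg hc0 (hP0 s)
    have p2 := mul_nonneg hc0 (hP0 (s - η))
    have p3 := mul_nonneg hd0 (hT0 (s - 1))
    rcases le_or_gt s (-1) with h1 | h1
    · rw [posPow_of_nonpos _ (by linarith), posPow_of_nonpos _ (by linarith)]
      simp only [sub_self, ne_eq, OfNat.ofNat_ne_zero, not_false_eq_true, zero_pow, zero_mul]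
      linarith
    rcases le_or_gt s 3 with h3 | h3
    · have e1 : P s = posPow (a - 1) s ^ 2 := by
        rw [posPow_sq, hP, indicator_of_mem]; simp; linarith
      have e2 : P (s - η) = posPow (a - 1) (s - η) ^ 2 := by
        rw [posPow_sq, hP, indicator_of_mem]; simp; linarith
      have hw : (1 + |s|) ^ (2 - a) ≤ (4:ℝ) ^ (2 - a) := by
        refine Real.rpow_le_rpow (by positivity) ?_ (by linarith)
        have : |s| ≤ 3 := abs_le.2 ⟨by linarith, h3⟩
        linarith
      have hsq : (posPow (a - 1) s - posPow (a - 1) (s - η)) ^ 2 ≤ 2 * (P s + P (s - η)) := by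
        rw [e1, e2]; nlinarith [sq_nonneg (posPow (a - 1) s + posPow (a - 1) (s - η))]
      have hn : 0 ≤ 2 * (P s + P (s - η)) := (sq_nonneg _).trans hsq
      calc _ ≤ 2 * (P s + P (s - η)) * (4:ℝ) ^ (2 - a) := by gcongr
        _ = c * P s + c * P (s - η) := by rw [hc]; ring
        _ ≤ _ := by linarith
    · rw [posPow_of_pos _ (by linarith), posPow_of_pos _ (by linarith)]
      have hs1 : 0 < s - 1 := by linarith
      have e3 : T (s - 1) = (s - 1) ^ (a - 2) := by
        rw [hT, indicator_of_mem]; simp; linarith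
      have hd1 := abs_rpow_sub_rpow_le (a := a) (u := s) (v := s - η) (w := s - 1)
        (by linarith) ha1 hs1 (by linarith) (by linarith)
      have hd2 : |s ^ (a - 1) - (s - η) ^ (a - 1)| ≤ (s - 1) ^ (a - 2) := by
        refine hd1.trans (mul_le_of_le_one_right (Real.rpow_nonneg hs1.le _) ?_)
        simpa using hη
      have hw : (1 + |s|) ^ (2 - a) ≤ d * (s - 1) ^ (2 - a) := by
        rw [hd, ← Real.mul_rpow (by norm_num) hs1.le]
        refine Real.rpow_le_rpow (by positivity) ?_ (by linarith)
        rw [abs_of_pos (by linarith)]; linarith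
      have hsq : (s ^ (a - 1) - (s - η) ^ (a - 1)) ^ 2 ≤ ((s - 1) ^ (a - 2)) ^ 2 := by
        rw [← sq_abs]; gcongr
      have hinv : (s - 1) ^ (a - 2) * (s - 1) ^ (2 - a) = 1 := by
        rw [← Real.rpow_add hs1]; simp
      calc _ ≤ ((s - 1) ^ (a - 2)) ^ 2 * (d * (s - 1) ^ (2 - a)) := by gcongr
        _ = d * T (s - 1) * ((s - 1) ^ (a - 2) * (s - 1) ^ (2 - a)) := by rw [e3]; ring
        _ = d * T (s - 1) := by rw [hinv, mul_one]
        _ ≤ _ := by linarith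
  have hi : Integrable (fun s => (posPow (a - 1) s - posPow (a - 1) (s - η)) ^ 2 *
        (1 + |s|) ^ (2 - a)) := by
    refine i5.mono' (Measurable.aestronglyMeasurable (by fun_prop))
      (Filter.Eventually.of_forall fun s => ?_)
    rw [Real.norm_of_nonneg (by positivity)]
    exact hle s
  refine ⟨hi, (integral_mono hi i5 hle).trans ?_⟩
  rw [integral_add i4 i3, integral_add i1 i2]
  simp_rw [MeasureTheory.integral_const_mul]
  rw [integral_sub_right_eq_self P η, integral_sub_right_eq_self T 1]

lemma exists_weighted_difference_bound {a : ℝ} (ha0 : 1 / 2 < a) (ha1 : a < 1) :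
    ∃ K : ℝ, 0 ≤ K ∧ ∀ h : ℝ, 0 < h → ∀ x y : ℝ, |x - y| ≤ h →
      Integrable (fun t => (posPow (a - 1) (x - t) - posPow (a - 1) (y - t)) ^ 2 *
        (1 + |(x - t) / h|) ^ (2 - a)) ∧
      ∫ t, (posPow (a - 1) (x - t) - posPow (a - 1) (y - t)) ^ 2 *
        (1 + |(x - t) / h|) ^ (2 - a) ≤ K * h ^ (2 * a - 1) := by
  obtain ⟨K, hK0, hK⟩ := exists_weighted_difference_bound_unit ha0 ha1
  refine ⟨K, hK0, fun h hh x y hxy => ?_⟩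
  obtain ⟨hi, hle⟩ := hK ((x - y) / h) (by rw [abs_div, abs_of_pos hh]; exact (div_le_one hh).2 hxy)
  set Φ : ℝ → ℝ := fun s => (posPow (a - 1) s - posPow (a - 1) (s - (x - y) / h)) ^ 2 *
        (1 + |s|) ^ (2 - a) with hΦ
  have hF : (fun t => (posPow (a - 1) (x - t) - posPow (a - 1) (y - t)) ^ 2 *
        (1 + |(x - t) / h|) ^ (2 - a)) = fun t => h ^ (2 * (a - 1)) * Φ ((x - t) / h) := by
    ext t
    have e1 : x - t = h * ((x - t) / h) := by field_simp
    have e2 : y - t = h * ((x - t) / h - (x - y) / h) := by field_simp; ring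
    have e3 : h ^ (2 * (a - 1)) = (h ^ (a - 1)) ^ 2 := by
      rw [← Real.rpow_natCast, ← Real.rpow_mul hh.le, mul_comm]; simp
    rw [hΦ, e3]
    simp only
    rw [← mul_assoc, ← mul_pow, mul_sub, ← posPow_mul _ hh, ← posPow_mul _ hh, ← e1, ← e2]
  have i1 : Integrable (fun t => Φ ((x - t) / h)) := (hi.comp_div hh.ne').comp_sub_left x
  rw [hF]
  refine ⟨i1.const_mul _, ?_⟩
  rw [MeasureTheory.integral_const_mul,
    integral_sub_left_eq_self (fun t => Φ (t / h)) volume x, Measure.integral_comp_div,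
    smul_eq_mul, abs_of_pos hh, show 2 * a - 1 = 2 * (a - 1) + 1 by ring, Real.rpow_add_one hh.ne']
  have := Real.rpow_nonneg hh.le (2 * (a - 1))
  calc h ^ (2 * (a - 1)) * (h * ∫ s, Φ s) ≤ h ^ (2 * (a - 1)) * (h * K) := by gcongr
    _ = _ := by ring

/-- The `L²` distance of two translates of a truncated power, as a power of the displacement. -/
lemma exists_integral_sq_difference {a : ℝ} (ha0 : 1 / 2 < a) (ha1 : a < 1) :
    ∃ C : ℝ, 0 ≤ C ∧ ∀ x z : ℝ,
      Integrable (fun t => (posPow (a - 1) (t - x) - posPow (a - 1) (t - z)) ^ 2) ∧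
      ∫ t, (posPow (a - 1) (t - x) - posPow (a - 1) (t - z)) ^ 2 = C * |x - z| ^ (2 * a - 1) := by
  obtain ⟨K, hK0, hK⟩ := exists_weighted_difference_bound_unit ha0 ha1
  have hi : Integrable (fun s => (posPow (a - 1) s - posPow (a - 1) (s - 1)) ^ 2) := by
    refine (hK 1 (by simp)).1.mono' (Measurable.aestronglyMeasurable (by fun_prop))
      (Filter.Eventually.of_forall fun s => ?_)
    rw [Real.norm_of_nonneg (by positivity)]
    exact le_mul_of_one_le_right (by positivity)
      (Real.one_le_rpow (by linarith [abs_nonneg s]) (by linarith))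
  set Φ : ℝ → ℝ := fun s => (posPow (a - 1) s - posPow (a - 1) (s - 1)) ^ 2 with hΦ
  have key : ∀ x z : ℝ, x < z →
      Integrable (fun t => (posPow (a - 1) (t - x) - posPow (a - 1) (t - z)) ^ 2) ∧
      ∫ t, (posPow (a - 1) (t - x) - posPow (a - 1) (t - z)) ^ 2 =
        (∫ s, Φ s) * |x - z| ^ (2 * a - 1) := by
    intro x z hxz
    have hL : 0 < z - x := by linarith
    have hF : (fun t => (posPow (a - 1) (t - x) - posPow (a - 1) (t - z)) ^ 2) =
        fun t => (z - x) ^ (2 * (a - 1)) * Φ ((t - x) / (z - x)) := by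
      ext t
      have e1 : t - x = (z - x) * ((t - x) / (z - x)) := by field_simp
      have e2 : t - z = (z - x) * ((t - x) / (z - x) - 1) := by field_simp; ring
      have e3 : (z - x) ^ (2 * (a - 1)) = ((z - x) ^ (a - 1)) ^ 2 := by
        rw [← Real.rpow_natCast, ← Real.rpow_mul hL.le, mul_comm]; simp
      rw [hΦ, e3]
      simp only
      rw [← mul_pow, mul_sub, ← posPow_mul _ hL, ← posPow_mul _ hL, ← e1, ← e2]
    rw [hF]
    have i1 : Integrable (fun t => Φ ((t - x) / (z - x))) :=
      (hi.comp_div hL.ne').comp_sub_right x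
    refine ⟨i1.const_mul _, ?_⟩
    rw [MeasureTheory.integral_const_mul,
      integral_sub_right_eq_self (fun t => Φ (t / (z - x))) x, Measure.integral_comp_div,
      smul_eq_mul, abs_of_pos hL, abs_sub_comm, abs_of_pos hL,
      show 2 * a - 1 = 2 * (a - 1) + 1 by ring, Real.rpow_add_one hL.ne']
    ring
  refine ⟨∫ s, Φ s, integral_nonneg fun s => sq_nonneg _, fun x z => ?_⟩
  rcases lt_trichotomy x z with h | h | h
  · exact key x z h
  · subst h
    have : 2 * a - 1 ≠ 0 := by linarith
    simp [Real.zero_rpow this]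
  · have := key z x h
    rw [abs_sub_comm]
    simp_rw [sub_sq_comm (posPow (a - 1) (_ - x))]
    exact this

lemma ae_integrable_posPow_mul {r : ℝ} (hr : -1 < r) {μ : Measure ℝ} [IsFiniteMeasure μ]
    {ρ : ℝ → ℝ} (hρ : Integrable ρ μ) (hρ0 : ∀ z, z ∉ Icc (0:ℝ) 1 → ρ z = 0) :
    ∀ᵐ t : ℝ, Integrable (fun x => posPow r (t - x) * ρ x) μ := by
  have key : ∀ n : ℕ, ∀ᵐ t : ℝ, t ∈ Iic (n:ℝ) →
      Integrable (fun x => posPow r (t - x) * ρ x) μ := by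
    intro n
    rw [← ae_restrict_iff' measurableSet_Iic]
    set ν : Measure ℝ := volume.restrict (Iic (n:ℝ)) with hν
    have hm : AEStronglyMeasurable (fun w : ℝ × ℝ => posPow r (w.1 - w.2) * ρ w.2) (ν.prod μ) :=
      AEStronglyMeasurable.mul (Measurable.aestronglyMeasurable (by fun_prop))
        hρ.aestronglyMeasurable.comp_snd
    have hx : ∀ x : ℝ, Integrable (fun t => posPow r (t - x)) ν ∧
        ∫ t, posPow r (t - x) ∂ν = ∫ s in Iic (n - x : ℝ), posPow r s := by
      intro x
      have e : indicator (Iic (n:ℝ)) (fun t => posPow r (t - x)) =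
          fun t => indicator (Iic (n - x : ℝ)) (posPow r) (t - x) := by
        ext t
        simp [indicator]
      rw [hν, ← MeasureTheory.integral_indicator measurableSet_Iic, ← IntegrableOn,
        ← integrable_indicator_iff measurableSet_Iic, e, integral_sub_right_eq_self,
        MeasureTheory.integral_indicator measurableSet_Iic]
      refine ⟨Integrable.comp_sub_right ?_ x, rfl⟩
      rw [integrable_indicator_iff measurableSet_Iic]
      exact integrableOn_posPow_Iic hr _
    have hjoint : Integrable (fun w : ℝ × ℝ => posPow r (w.1 - w.2) * ρ w.2) (ν.prod μ) := by
      rw [integrable_prod_iff' hm]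
      refine ⟨Filter.Eventually.of_forall fun x => (hx x).1.mul_const (ρ x), ?_⟩
      refine (hρ.norm.const_mul (∫ s in Iic (n : ℝ), posPow r s)).mono'
        hm.norm.prod_swap.integral_prod_right' (Filter.Eventually.of_forall fun x => ?_)
      simp only [norm_mul]
      rw [MeasureTheory.integral_mul_const, norm_mul, norm_norm]
      simp_rw [Real.norm_of_nonneg (posPow_nonneg _ _)]
      rw [Real.norm_of_nonneg (integral_nonneg fun t => posPow_nonneg _ _), (hx x).2]
      by_cases h : x ∈ Icc (0:ℝ) 1
      · refine mul_le_mul_of_nonneg_right ?_ (norm_nonneg _)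
        refine setIntegral_mono_set (integrableOn_posPow_Iic hr _)
          (Filter.Eventually.of_forall fun t => posPow_nonneg _ _) ?_
        exact (Iic_subset_Iic.2 (by linarith [h.1])).eventuallyLE
      · simp [hρ0 x h]
    exact hjoint.prod_right_ae
  filter_upwards [ae_all_iff.2 key] with t ht
  obtain ⟨n, hn⟩ := exists_nat_ge t
  exact ht n hn

lemma abs_rpow_eq_posPow_add {b : ℝ} (hb : 0 < b) (s : ℝ) :
    |s| ^ b = posPow b s + posPow b (-s) := by
  rcases lt_trichotomy s 0 with h | h | h
  · rw [posPow_of_nonpos b h.le, posPow_of_pos b (by linarith), abs_of_neg h, zero_add]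
  · subst h; simp [posPow, Real.zero_rpow hb.ne']
  · rw [posPow_of_nonpos (s := -s) b (by linarith), posPow_of_pos b h, abs_of_pos h, add_zero]

lemma abs_posPow_mul_mul_le {b : ℝ} (hb : 0 < b) {ρ : ℝ → ℝ}
    (hρ0 : ∀ z, z ∉ Icc (0:ℝ) 1 → ρ z = 0) (x z : ℝ) :
    ‖posPow b (x - z) * (ρ x * ρ z)‖ ≤ ‖ρ x * ρ z‖ := by
  by_cases hx : x ∈ Icc (0:ℝ) 1
  · by_cases hz : z ∈ Icc (0:ℝ) 1
    · rw [norm_mul]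
      refine mul_le_of_le_one_left (norm_nonneg _) ?_
      rw [Real.norm_of_nonneg (posPow_nonneg _ _)]
      unfold posPow
      split_ifs with h
      · exact Real.rpow_le_one h.le (by linarith [hx.2, hz.1]) hb.le
      · exact zero_le_one
    · simp [hρ0 z hz]
  · simp [hρ0 x hx]

/-- For a neutral charge `ρ μ` on `[0,1]`, the energy of the one-sided potential is the squared
`L²` norm of the half-order potential. -/
lemma exists_energy_identity {a : ℝ} (ha0 : 1 / 2 < a) (ha1 : a < 1) :
    ∃ C : ℝ, 0 ≤ C ∧ ∀ (μ : Measure ℝ) [IsFiniteMeasure μ] (ρ : ℝ → ℝ), Integrable ρ μ →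
      (∀ z, z ∉ Icc (0:ℝ) 1 → ρ z = 0) → ∫ z, ρ z ∂μ = 0 →
      Integrable (fun t => (∫ z, posPow (a - 1) (t - z) * ρ z ∂μ) ^ 2) ∧
      ∫ t, (∫ z, posPow (a - 1) (t - z) * ρ z ∂μ) ^ 2 =
        -C * ∫ x, (∫ z, posPow (2 * a - 1) (x - z) * ρ z ∂μ) * ρ x ∂μ := by
  obtain ⟨C, hC0, hC⟩ := exists_integral_sq_difference ha0 ha1
  have hb : 0 < 2 * a - 1 := by linarith
  refine ⟨C, hC0, fun μ _ ρ hρ hρ0 hρz => ?_⟩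
  have hρρ : Integrable (fun w : ℝ × ℝ => ρ w.1 * ρ w.2) (μ.prod μ) := hρ.mul_prod hρ
  have hp1 : Integrable (fun w : ℝ × ℝ => posPow (2 * a - 1) (w.1 - w.2) * (ρ w.1 * ρ w.2))
      (μ.prod μ) :=
    hρρ.norm.mono' (AEStronglyMeasurable.mul (Measurable.aestronglyMeasurable (by fun_prop))
        hρρ.aestronglyMeasurable)
      (Filter.Eventually.of_forall fun w => abs_posPow_mul_mul_le hb hρ0 w.1 w.2)
  have hp2 : Integrable (fun w : ℝ × ℝ => posPow (2 * a - 1) (w.2 - w.1) * (ρ w.2 * ρ w.1))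
      (μ.prod μ) := hp1.swap
  have hsum : (fun w : ℝ × ℝ => |w.1 - w.2| ^ (2 * a - 1) * (ρ w.1 * ρ w.2)) =
      fun w => posPow (2 * a - 1) (w.1 - w.2) * (ρ w.1 * ρ w.2) +
        posPow (2 * a - 1) (w.2 - w.1) * (ρ w.2 * ρ w.1) := by
    ext w
    rw [abs_rpow_eq_posPow_add hb, neg_sub]; ring
  have hE : ∫ w : ℝ × ℝ, |w.1 - w.2| ^ (2 * a - 1) * (ρ w.1 * ρ w.2) ∂(μ.prod μ) =
      2 * ∫ x, (∫ z, posPow (2 * a - 1) (x - z) * ρ z ∂μ) * ρ x ∂μ := by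
    have e1 : ∫ w : ℝ × ℝ, posPow (2 * a - 1) (w.1 - w.2) * (ρ w.1 * ρ w.2) ∂(μ.prod μ) =
        ∫ x, (∫ z, posPow (2 * a - 1) (x - z) * ρ z ∂μ) * ρ x ∂μ := by
      rw [integral_prod _ hp1]
      refine MeasureTheory.integral_congr_ae (Filter.Eventually.of_forall fun x => ?_)
      simp only
      rw [← MeasureTheory.integral_mul_const]
      congr 1; ext z; ring
    have e2 := integral_prod_swap (μ := μ) (ν := μ)
      (fun w : ℝ × ℝ => posPow (2 * a - 1) (w.1 - w.2) * (ρ w.1 * ρ w.2))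
    simp only [Prod.fst_swap, Prod.snd_swap] at e2
    rw [hsum, integral_add hp1 hp2, e2, e1]; ring
  have hm : AEStronglyMeasurable (fun w : ℝ × (ℝ × ℝ) =>
      (posPow (a - 1) (w.1 - w.2.1) - posPow (a - 1) (w.1 - w.2.2)) ^ 2 * (ρ w.2.1 * ρ w.2.2))
      (volume.prod (μ.prod μ)) :=
    AEStronglyMeasurable.mul (Measurable.aestronglyMeasurable (by fun_prop))
      hρρ.aestronglyMeasurable.comp_snd
  have hjoint : Integrable (fun w : ℝ × (ℝ × ℝ) =>
      (posPow (a - 1) (w.1 - w.2.1) - posPow (a - 1) (w.1 - w.2.2)) ^ 2 * (ρ w.2.1 * ρ w.2.2))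
      (volume.prod (μ.prod μ)) := by
    rw [integrable_prod_iff' hm]
    refine ⟨Filter.Eventually.of_forall fun w => (hC w.1 w.2).1.mul_const (ρ w.1 * ρ w.2), ?_⟩
    have hi : Integrable (fun w : ℝ × ℝ => C * ‖|w.1 - w.2| ^ (2 * a - 1) * (ρ w.1 * ρ w.2)‖)
        (μ.prod μ) := by
      refine Integrable.const_mul (Integrable.norm ?_) C
      rw [hsum]; exact hp1.add hp2
    refine hi.congr (Filter.Eventually.of_forall fun w => ?_)
    simp only [norm_mul (_ ^ 2)]
    rw [MeasureTheory.integral_mul_const]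
    simp_rw [Real.norm_of_nonneg (sq_nonneg _)]
    rw [(hC w.1 w.2).2, norm_mul, Real.norm_of_nonneg (by positivity)]; ring
  have hφ : ∀ᵐ t : ℝ, ∫ w : ℝ × ℝ, (posPow (a - 1) (t - w.1) - posPow (a - 1) (t - w.2)) ^ 2 *
      (ρ w.1 * ρ w.2) ∂(μ.prod μ) = -2 * (∫ z, posPow (a - 1) (t - z) * ρ z ∂μ) ^ 2 := by
    filter_upwards [ae_integrable_posPow_mul (r := a - 1) (by linarith) hρ hρ0,
      ae_integrable_posPow_mul (r := 2 * (a - 1)) (by linarith) hρ hρ0] with t h1 h2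
    have j1 := h2.mul_prod hρ
    have j2 := (h1.mul_prod h1).const_mul (-2)
    have j3 := hρ.mul_prod h2
    have e : (fun w : ℝ × ℝ => (posPow (a - 1) (t - w.1) - posPow (a - 1) (t - w.2)) ^ 2 *
        (ρ w.1 * ρ w.2)) = fun w =>
        posPow (2 * (a - 1)) (t - w.1) * ρ w.1 * ρ w.2 +
        -2 * (posPow (a - 1) (t - w.1) * ρ w.1 * (posPow (a - 1) (t - w.2) * ρ w.2)) +
        ρ w.1 * (posPow (2 * (a - 1)) (t - w.2) * ρ w.2) := by
      ext w
      rw [← posPow_sq, ← posPow_sq]; ring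
    have j4 : Integrable (fun w : ℝ × ℝ => posPow (2 * (a - 1)) (t - w.1) * ρ w.1 * ρ w.2 +
        -2 * (posPow (a - 1) (t - w.1) * ρ w.1 * (posPow (a - 1) (t - w.2) * ρ w.2)))
        (μ.prod μ) := j1.add j2
    rw [e, integral_add j4 j3, integral_add j1 j2, MeasureTheory.integral_const_mul,
      integral_prod_mul (fun z => posPow (2 * (a - 1)) (t - z) * ρ z) ρ,
      integral_prod_mul (fun z => posPow (a - 1) (t - z) * ρ z)
        (fun z => posPow (a - 1) (t - z) * ρ z),
      integral_prod_mul ρ (fun z => posPow (2 * (a - 1)) (t - z) * ρ z), hρz]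
    ring
  have hl := hjoint.integral_prod_left
  refine ⟨(hl.const_mul (-(1/2))).congr ?_, ?_⟩
  · filter_upwards [hφ] with t ht
    rw [ht]; ring
  · have hsw := integral_integral_swap (f := fun (t : ℝ) (w : ℝ × ℝ) =>
      (posPow (a - 1) (t - w.1) - posPow (a - 1) (t - w.2)) ^ 2 * (ρ w.1 * ρ w.2)) hjoint
    rw [MeasureTheory.integral_congr_ae hφ, MeasureTheory.integral_const_mul] at hsw
    simp_rw [MeasureTheory.integral_mul_const, (hC _ _).2, mul_assoc] at hsw
    rw [MeasureTheory.integral_const_mul, hE] at hsw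
    linarith

/-- Sampling inequality: a half-order potential with zeros at distance at most `h` from every point
of `(0,1)` is small in `L²`. -/
lemma exists_sampling_bound {a : ℝ} (ha0 : 1 / 2 < a) (ha1 : a < 1) :
    ∃ K : ℝ, 0 ≤ K ∧ ∀ (φ E : ℝ → ℝ) (h : ℝ), 0 < h → AEStronglyMeasurable φ →
      Integrable (fun t => φ t ^ 2) →
      (∀ x ∈ Icc (0:ℝ) 1, Integrable (fun t => posPow (a - 1) (x - t) * φ t) ∧
        ∫ t, posPow (a - 1) (x - t) * φ t = E x) →
      IntegrableOn (fun x => E x ^ 2) (Ioo 0 1) →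
      (∀ x ∈ Ioo (0:ℝ) 1, ∃ y ∈ Icc (0:ℝ) 1, |x - y| ≤ h ∧ E y = 0) →
      ∫ x in Ioo (0:ℝ) 1, E x ^ 2 ≤ K * h ^ (2 * a) * ∫ t, φ t ^ 2 := by
  obtain ⟨K, hK0, hK⟩ := exists_weighted_difference_bound ha0 ha1
  set m : ℝ → ℝ := fun s => (1 + |s|) ^ (-(2 - a)) with hm
  have hm0 : ∀ s, 0 ≤ m s := fun s => by rw [hm]; positivity
  have im : Integrable m := by
    have := integrable_one_add_norm (E := ℝ) (μ := volume) (r := 2 - a) (by simp; linarith)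
    simpa only [Real.norm_eq_abs] using this
  refine ⟨K * ∫ s, m s, mul_nonneg hK0 (integral_nonneg hm0), ?_⟩
  intro φ E h hh hφm hφ hE hE2 hzero
  have imh : Integrable (fun s => m (s / h)) := im.comp_div hh.ne'
  have iconv := hφ.integrable_convolution (ContinuousLinearMap.mul ℝ ℝ) imh
  have hconv := integral_convolution (ContinuousLinearMap.mul ℝ ℝ) hφ imh
  set Ψ : ℝ → ℝ := fun x => ∫ t, φ t ^ 2 * m ((x - t) / h) with hΨ
  have hΨ0 : ∀ x, 0 ≤ Ψ x := fun x =>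
    integral_nonneg fun t => mul_nonneg (sq_nonneg _) (hm0 _)
  change Integrable Ψ at iconv
  change ∫ x, Ψ x = (∫ t, φ t ^ 2) * ∫ s, m (s / h) at hconv
  rw [Measure.integral_comp_div m, smul_eq_mul, abs_of_pos hh] at hconv
  have hpt : ∀ x ∈ Ioo (0:ℝ) 1, E x ^ 2 ≤ K * h ^ (2 * a - 1) * Ψ x := by
    intro x hx
    obtain ⟨y, hyI, hxy, hy⟩ := hzero x hx
    have hxI := Ioo_subset_Icc_self hx
    obtain ⟨hD, hDle⟩ := hK h hh x y hxy
    set v : ℝ → ℝ := fun t => (1 + |(x - t) / h|) ^ ((2 - a) / 2) with hv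
    have hvpos : ∀ t, 0 < v t := fun t => by rw [hv]; positivity
    have hv2 : ∀ t, v t ^ 2 = (1 + |(x - t) / h|) ^ (2 - a) := fun t => by
      rw [hv, ← Real.rpow_natCast, ← Real.rpow_mul (by positivity)]; congr 1; push_cast; ring
    have hvm : ∀ t, (v t)⁻¹ ^ 2 = m ((x - t) / h) := fun t => by
      rw [inv_pow, hv2, hm]; exact (Real.rpow_neg (by positivity) _).symm
    have hvmeas : Measurable v := by rw [hv]; fun_prop
    have i1 : Integrable
        (fun t => ((posPow (a - 1) (x - t) - posPow (a - 1) (y - t)) * v t) ^ 2) := by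
      simp_rw [mul_pow, hv2]; exact hD
    have i2 : Integrable (fun t => (φ t * (v t)⁻¹) ^ 2) := by
      have h1 : Integrable (fun t => φ t ^ 2 * 1) := by simpa using hφ
      refine h1.mono' (by fun_prop) (Filter.Eventually.of_forall fun t => ?_)
      rw [Real.norm_of_nonneg (sq_nonneg _), mul_pow, hvm]
      refine mul_le_mul_of_nonneg_left ?_ (sq_nonneg _)
      exact Real.rpow_le_one_of_one_le_of_nonpos (by simp) (by linarith)
    have hcs := (sq_integral_mul_le (Measurable.aestronglyMeasurable (by fun_prop))
      (by fun_prop) i1 i2).2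
    have hEx : ∫ t, (posPow (a - 1) (x - t) - posPow (a - 1) (y - t)) * v t *
        (φ t * (v t)⁻¹) = E x := by
      have e : (fun t => (posPow (a - 1) (x - t) - posPow (a - 1) (y - t)) * v t *
          (φ t * (v t)⁻¹)) =
          fun t => posPow (a - 1) (x - t) * φ t - posPow (a - 1) (y - t) * φ t := by
        ext t
        have := (hvpos t).ne'
        field_simp
      rw [e, integral_sub (hE x hxI).1 (hE y hyI).1, (hE x hxI).2, (hE y hyI).2, hy, sub_zero]
    rw [hEx] at hcs
    simp_rw [mul_pow, hvm, hv2] at hcs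
    exact hcs.trans (mul_le_mul_of_nonneg_right hDle (hΨ0 x))
  calc ∫ x in Ioo (0:ℝ) 1, E x ^ 2 ≤ ∫ x in Ioo (0:ℝ) 1, K * h ^ (2 * a - 1) * Ψ x :=
        setIntegral_mono_on hE2 (iconv.integrableOn.const_mul _) measurableSet_Ioo hpt
    _ = K * h ^ (2 * a - 1) * ∫ x in Ioo (0:ℝ) 1, Ψ x := MeasureTheory.integral_const_mul _ _
    _ ≤ K * h ^ (2 * a - 1) * ∫ x, Ψ x := by
        refine mul_le_mul_of_nonneg_left (setIntegral_le_integral iconv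
          (Filter.Eventually.of_forall hΨ0)) (by positivity)
    _ = _ := by
        rw [hconv, show 2 * a = (2 * a - 1) + 1 by ring, Real.rpow_add_one hh.ne']
        ring_nf

lemma posPow_le_one {r s : ℝ} (hr : 0 ≤ r) (hs : s ≤ 1) : posPow r s ≤ 1 := by
  unfold posPow
  split_ifs with h
  · exact Real.rpow_le_one h.le hs hr
  · exact zero_le_one

lemma continuous_posPow {r : ℝ} (hr : 0 < r) : Continuous (posPow r) := by
  have : posPow r = fun s => max s 0 ^ r := by
    ext s
    unfold posPow
    split_ifs with h
    · rw [max_eq_left h.le]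
    · rw [max_eq_right (not_lt.1 h), Real.zero_rpow hr.ne']
  rw [this]
  exact (continuous_id.max continuous_const).rpow_const fun _ => Or.inr hr.le

lemma norm_posPow_mul_le {r x z y : ℝ} (hr : 0 ≤ r) (hx : x ≤ 1) (hz : z < 0 → y = 0) :
    ‖posPow r (x - z) * y‖ ≤ ‖y‖ := by
  rcases lt_or_ge z 0 with h | h
  · simp [hz h]
  · rw [norm_mul, Real.norm_of_nonneg (posPow_nonneg _ _)]
    exact mul_le_of_le_one_left (norm_nonneg _) (posPow_le_one hr (by linarith))

lemma integrable_posPow_mul {r x : ℝ} (hr : 0 ≤ r) (hx : x ≤ 1) {μ : Measure ℝ} {ρ : ℝ → ℝ}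
    (hρ : Integrable ρ μ) (hρ0 : ∀ᵐ z ∂μ, z < 0 → ρ z = 0) :
    Integrable (fun z => posPow r (x - z) * ρ z) μ := by
  refine hρ.norm.mono' (AEStronglyMeasurable.mul (Measurable.aestronglyMeasurable (by fun_prop))
    hρ.aestronglyMeasurable) ?_
  filter_upwards [hρ0] with z hz using norm_posPow_mul_le hr hx hz

lemma continuousOn_integral_posPow {r : ℝ} (hr : 0 < r) {μ : Measure ℝ} {ρ : ℝ → ℝ}
    (hρ : Integrable ρ μ) (hρ0 : ∀ᵐ z ∂μ, z < 0 → ρ z = 0) :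
    ContinuousOn (fun x => ∫ z, posPow r (x - z) * ρ z ∂μ) (Icc 0 1) := by
  refine continuousOn_of_dominated (bound := fun z => ‖ρ z‖)
    (fun x hx => (integrable_posPow_mul hr.le hx.2 hρ hρ0).aestronglyMeasurable)
    (fun x hx => ?_) hρ.norm (Filter.Eventually.of_forall fun z => ?_)
  · filter_upwards [hρ0] with z hz using norm_posPow_mul_le hr.le hx.2 hz
  · exact (((continuous_posPow hr).comp (continuous_id.sub continuous_const)).mul
      continuous_const).continuousOn

lemma setIntegral_posPow_mul (r : ℝ) (u : ℝ → ℝ) {x : ℝ} (hx : x ∈ Icc (0:ℝ) 1) :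
    ∫ z in Ioo (0:ℝ) 1, posPow r (x - z) * u z = ∫ z in (0:ℝ)..x, (x - z) ^ r * u z := by
  rw [integral_of_le hx.1, integral_Ioc_eq_integral_Ioo,
    ← MeasureTheory.integral_indicator measurableSet_Ioo,
    ← MeasureTheory.integral_indicator measurableSet_Ioo]
  congr 1; ext z
  by_cases h : z ∈ Ioo 0 x
  · rw [indicator_of_mem h, indicator_of_mem (Ioo_subset_Ioo_right hx.2 h),
      posPow_of_pos _ (by linarith [h.2])]
  · rw [indicator_of_notMem h]
    by_cases h1 : z ∈ Ioo (0:ℝ) 1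
    · have : x ≤ z := by
        by_contra! hlt; exact h ⟨h1.1, hlt⟩
      rw [indicator_of_mem h1, posPow_of_nonpos _ (by linarith), zero_mul]
    · rw [indicator_of_notMem h1]

lemma integral_posPow_zero_mul {u : ℝ → ℝ} (hu : ∀ t ≤ 0, u t = 0) {x : ℝ}
    (hx : x ∈ Icc (0:ℝ) 1) :
    ∫ t, posPow 0 (x - t) * u t = ∫ t in (0:ℝ)..x, u t := by
  have h1 : ∫ t, posPow 0 (x - t) * u t = ∫ t in Ioo (0:ℝ) 1, posPow 0 (x - t) * u t := by
    refine (setIntegral_eq_integral_of_forall_compl_eq_zero fun t ht => ?_).symm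
    rw [mem_Ioo, not_and_or] at ht
    rcases ht with ht | ht
    · rw [hu t (not_lt.1 ht), mul_zero]
    · rw [posPow_of_nonpos _ (by linarith [hx.2]), zero_mul]
  rw [h1, setIntegral_posPow_mul 0 u hx]
  simp

lemma hasDerivAt_integral_of_continuousOn {u : ℝ → ℝ} (hu : ContinuousOn u (Icc 0 1)) {x : ℝ}
    (hx : x ∈ Ioo (0:ℝ) 1) : HasDerivAt (fun y => ∫ t in (0:ℝ)..y, u t) (u x) x := by
  refine integral_hasDerivAt_right ?_ ?_ (hu.continuousAt (Icc_mem_nhds hx.1 hx.2))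
  · refine (hu.mono ?_).intervalIntegrable
    rw [uIcc_of_le hx.1.le]
    exact Icc_subset_Icc_right hx.2.le
  · exact (hu.mono Ioo_subset_Icc_self).stronglyMeasurableAtFilter isOpen_Ioo x hx

lemma eq_zero_of_tendsto_affine_div {A B : ℝ}
    (h : Filter.Tendsto (fun x : ℝ => (A + B * x) / x) (nhdsWithin 0 (Ioi 0)) (nhds 0)) :
    A = 0 ∧ B = 0 := by
  have hid : Filter.Tendsto (fun x : ℝ => x) (nhdsWithin 0 (Ioi 0)) (nhds 0) :=
    tendsto_nhdsWithin_of_tendsto_nhds Filter.tendsto_id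
  have hA : A = 0 := by
    have h1 := h.mul hid
    have h2 : Filter.Tendsto (fun x : ℝ => A + B * x) (nhdsWithin 0 (Ioi 0)) (nhds (A + B * 0)) :=
      tendsto_const_nhds.add (hid.const_mul B)
    have h3 : Filter.Tendsto (fun x : ℝ => A + B * x) (nhdsWithin 0 (Ioi 0)) (nhds (0 * 0)) := by
      refine h1.congr' ?_
      filter_upwards [self_mem_nhdsWithin] with x hx
      have : x ≠ 0 := ne_of_gt hx
      field_simp
    have := tendsto_nhds_unique h2 h3
    simpa using this
  refine ⟨hA, ?_⟩
  have h2 : Filter.Tendsto (fun _ : ℝ => B) (nhdsWithin 0 (Ioi 0)) (nhds 0) := by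
    refine h.congr' ?_
    filter_upwards [self_mem_nhdsWithin] with x hx
    have : x ≠ 0 := ne_of_gt hx
    rw [hA]; field_simp; ring
  exact tendsto_nhds_unique tendsto_const_nhds h2

lemma abs_fracIntL_le {α M : ℝ} (hα₂ : α < 2) {f : ℝ → ℝ}
    (hf : ∀ t ∈ Icc (0:ℝ) 1, |f t| ≤ M * t) (hM : 0 ≤ M) {x : ℝ} (hx : x ∈ Ioo (0:ℝ) 1) :
    |fracIntL α f x| ≤ (1 / Real.Gamma (2 - α)) * (M / (2 - α)) * x ^ (2 - α) * x := by
  have hΓ : 0 < Real.Gamma (2 - α) := Real.Gamma_pos_of_pos (by linarith)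
  have hi : IntervalIntegrable (fun t => (x - t) ^ (1 - α) * (M * x)) volume 0 x := by
    have := ((intervalIntegrable_rpow' (a := 0) (b := x) (r := 1 - α) (by linarith)).comp_sub_left
      x).symm
    simpa using this.mul_const (M * x)
  have hb : ‖∫ t in (0:ℝ)..x, (x - t) ^ (1 - α) * f t‖ ≤
      ∫ t in (0:ℝ)..x, (x - t) ^ (1 - α) * (M * x) := by
    refine norm_integral_le_of_norm_le hx.1.le (Filter.Eventually.of_forall fun t ht => ?_) hi
    have h0 : 0 ≤ (x - t) ^ (1 - α) := Real.rpow_nonneg (by linarith [ht.2]) _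
    rw [norm_mul, Real.norm_of_nonneg h0, Real.norm_eq_abs]
    refine mul_le_mul_of_nonneg_left ((hf t ⟨ht.1.le, by linarith [ht.2, hx.2]⟩).trans ?_) h0
    exact mul_le_mul_of_nonneg_left ht.2 hM
  have hv : ∫ t in (0:ℝ)..x, (x - t) ^ (1 - α) * (M * x) = x ^ (2 - α) / (2 - α) * (M * x) := by
    rw [intervalIntegral.integral_mul_const,
      intervalIntegral.integral_comp_sub_left (fun s => s ^ (1 - α)) x, sub_self, sub_zero,
      integral_rpow (Or.inl (by linarith)), show 1 - α + 1 = 2 - α by ring,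
      Real.zero_rpow (by linarith), sub_zero]
  rw [hv, Real.norm_eq_abs] at hb
  unfold fracIntL
  rw [abs_mul, abs_of_pos (by positivity)]
  calc _ ≤ 1 / Real.Gamma (2 - α) * (x ^ (2 - α) / (2 - α) * (M * x)) := by gcongr
    _ = _ := by ring

lemma exists_abs_le_mul_of_hasDerivWithinAt {f f' : ℝ → ℝ}
    (hf : ∀ x ∈ Icc (0:ℝ) 1, HasDerivWithinAt f (f' x) (Icc 0 1) x)
    (hf' : ContinuousOn f' (Icc 0 1)) (hf0 : f 0 = 0) :
    ∃ M : ℝ, 0 ≤ M ∧ ∀ t ∈ Icc (0:ℝ) 1, |f t| ≤ M * t := by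
  obtain ⟨M, hM⟩ := isCompact_Icc.exists_bound_of_continuousOn hf'
  have h0 : (0:ℝ) ∈ Icc (0:ℝ) 1 := by simp
  refine ⟨M, (norm_nonneg _).trans (hM 0 h0), fun t ht => ?_⟩
  have := (convex_Icc (0:ℝ) 1).norm_image_sub_le_of_norm_hasDerivWithin_le hf hM h0 ht
  rwa [hf0, sub_zero, sub_zero, Real.norm_eq_abs, Real.norm_of_nonneg ht.1] at this

/-- Under the vanishing initial data, the fractional integral is recovered from its second
derivative by two integrations from `0`. -/
lemma fracIntL_eq_integral_integral {α : ℝ} (hα₂ : α < 2) {f f' : ℝ → ℝ}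
    (hf : ∀ x ∈ Icc (0:ℝ) 1, HasDerivWithinAt f (f' x) (Icc 0 1) x)
    (hf' : ContinuousOn f' (Icc 0 1)) (hf0 : f 0 = 0)
    (hd : ∀ x ∈ Ioo (0:ℝ) 1, DifferentiableAt ℝ (fracIntL α f) x ∧
      DifferentiableAt ℝ (deriv (fracIntL α f)) x)
    (hg : IntervalIntegrable (deriv (deriv (fracIntL α f))) volume 0 1)
    {x : ℝ} (hx : x ∈ Ioo (0:ℝ) 1) :
    fracIntL α f x = ∫ t in (0:ℝ)..x, ∫ s in (0:ℝ)..t, deriv (deriv (fracIntL α f)) s := by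
  set F := fracIntL α f with hF
  set g := deriv (deriv F) with hgdef
  set P : ℝ → ℝ := fun t => ∫ s in (0:ℝ)..t, g s with hP
  set Q : ℝ → ℝ := fun t => ∫ s in (0:ℝ)..t, P s with hQ
  have hgi : ∀ y ∈ Icc (0:ℝ) 1, ∀ z ∈ Icc (0:ℝ) 1, IntervalIntegrable g volume y z := by
    intro y hy z hz
    refine hg.mono_set ?_
    rw [uIcc_of_le zero_le_one]
    exact uIcc_subset_Icc hy hz
  have hPc : ContinuousOn P (Icc 0 1) := by
    have := continuousOn_primitive_interval (f := g) (μ := volume) (a := 0) (b := 1)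
      ((intervalIntegrable_iff_integrableOn_Icc_of_le zero_le_one).1 hg |>.mono_set
        (by rw [uIcc_of_le zero_le_one]))
    rwa [uIcc_of_le zero_le_one] at this
  have hhalf : (1 / 2 : ℝ) ∈ Ioo (0:ℝ) 1 := by norm_num
  have hF' : ∀ y ∈ Ioo (0:ℝ) 1, deriv F y = (deriv F (1 / 2) - P (1 / 2)) + P y := by
    intro y hy
    have h1 : ∫ s in (1 / 2 : ℝ)..y, g s = deriv F y - deriv F (1 / 2) := by
      refine integral_eq_sub_of_hasDerivAt (fun s hs => ?_)
        (hgi _ (Ioo_subset_Icc_self hhalf) _ (Ioo_subset_Icc_self hy))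
      have hs' : s ∈ Ioo (0:ℝ) 1 := by
        rcases le_total (1 / 2) y with h | h
        · rw [uIcc_of_le h] at hs; exact ⟨by linarith [hs.1], by linarith [hs.2, hy.2]⟩
        · rw [uIcc_of_ge h] at hs; exact ⟨by linarith [hs.1, hy.1], by linarith [hs.2]⟩
      exact (hd s hs').2.hasDerivAt
    have h2 : P y - P (1 / 2) = ∫ s in (1 / 2 : ℝ)..y, g s :=
      integral_interval_sub_left (hgi _ (by simp) _ (Ioo_subset_Icc_self hy))
        (hgi _ (by simp) _ (Ioo_subset_Icc_self hhalf))
    linarith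
  set B := deriv F (1 / 2) - P (1 / 2) with hB
  have hR : ∀ y ∈ Ioo (0:ℝ) 1, HasDerivAt (fun y => F y - B * y - Q y) 0 y := by
    intro y hy
    have h1 := ((hd y hy).1.hasDerivAt.sub ((hasDerivAt_id y).const_mul B)).sub
      (hasDerivAt_integral_of_continuousOn hPc hy)
    have h2 : deriv F y - B * 1 - P y = 0 := by rw [hF' y hy]; ring
    rw [h2] at h1
    exact h1
  obtain ⟨A, hA⟩ : ∃ A, ∀ y ∈ Ioo (0:ℝ) 1, F y = A + B * y + Q y := by
    refine ⟨F (1 / 2) - B * (1 / 2) - Q (1 / 2), fun y hy => ?_⟩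
    have := isOpen_Ioo.is_const_of_deriv_eq_zero isPreconnected_Ioo
      (fun z hz => (hR z hz).differentiableAt.differentiableWithinAt)
      (fun z hz => (hR z hz).deriv) hy hhalf
    linarith
  have hmem : ∀ᶠ y in nhdsWithin (0:ℝ) (Ioi 0), y ∈ Ioo (0:ℝ) 1 :=
    Ioo_mem_nhdsGT one_pos
  have hlimF : Filter.Tendsto (fun y => F y / y) (nhdsWithin 0 (Ioi 0)) (nhds 0) := by
    obtain ⟨M, hM0, hM⟩ := exists_abs_le_mul_of_hasDerivWithinAt hf hf' hf0
    set c := 1 / Real.Gamma (2 - α) * (M / (2 - α)) with hc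
    have hlim : Filter.Tendsto (fun y : ℝ => c * y ^ (2 - α)) (nhdsWithin 0 (Ioi 0)) (nhds 0) := by
      have h1 : Continuous fun y : ℝ => c * y ^ (2 - α) :=
        continuous_const.mul (continuous_id.rpow_const fun _ => Or.inr (by linarith))
      have h2 := h1.tendsto 0
      rw [Real.zero_rpow (by linarith), mul_zero] at h2
      exact tendsto_nhdsWithin_of_tendsto_nhds h2
    refine squeeze_zero_norm' ?_ hlim
    filter_upwards [hmem] with y hy
    rw [norm_div, Real.norm_eq_abs, Real.norm_of_nonneg hy.1.le, div_le_iff₀ hy.1]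
    exact abs_fracIntL_le hα₂ hM hM0 hy
  have hlimQ : Filter.Tendsto (fun y => Q y / y) (nhdsWithin 0 (Ioi 0)) (nhds 0) := by
    have h0 : HasDerivWithinAt Q (P 0) (Ioi 0) 0 := by
      refine (integral_hasDerivWithinAt_right (a := 0) (s := Ici 0) (t := Ioi 0) (by simp)
        ?_ ?_).mono Ioi_subset_Ici_self
      · exact ⟨Ioo 0 1, Ioo_mem_nhdsGT one_pos,
          (hPc.mono Ioo_subset_Icc_self).aestronglyMeasurable measurableSet_Ioo⟩
      · have h1 : ContinuousWithinAt P (Icc 0 1) 0 := hPc 0 (by simp)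
        have h2 := h1.mono Ioo_subset_Icc_self
        exact h2.mono_of_mem_nhdsWithin (Ioo_mem_nhdsGT one_pos)
    rw [hasDerivWithinAt_iff_tendsto_slope' (by simp)] at h0
    have hP0 : P 0 = 0 := by simp [hP]
    have hQ0 : Q 0 = 0 := by simp [hQ]
    rw [hP0] at h0
    refine h0.congr fun y => ?_
    rw [slope_def_field, hQ0, sub_zero, sub_zero]
  have hAB : A = 0 ∧ B = 0 := by
    refine eq_zero_of_tendsto_affine_div ?_
    have := hlimF.sub hlimQ
    rw [sub_zero] at this
    refine this.congr' ?_
    filter_upwards [hmem] with y hy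
    rw [hA y hy]; ring
  rw [hA x hx, hAB.1, hAB.2]
  ring

lemma ae_nonneg_restrict_Ioo (u : ℝ → ℝ) :
    ∀ᵐ z ∂(volume.restrict (Ioo (0:ℝ) 1)), z < 0 → u z = 0 := by
  filter_upwards [ae_restrict_mem measurableSet_Ioo] with z hz hz0
  linarith [hz.1]

/-- A function with vanishing initial data is a multiple of the order-`α` fractional integral of its
Riemann–Liouville derivative. -/
lemma exists_eq_fractional_integral {α : ℝ} (hα₁ : 1 < α) (hα₂ : α < 2) :
    ∃ c : ℝ, ∀ f f' : ℝ → ℝ,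
      (∀ x ∈ Icc (0:ℝ) 1, HasDerivWithinAt f (f' x) (Icc 0 1) x) →
      ContinuousOn f' (Icc 0 1) → f 0 = 0 →
      (∀ x ∈ Ioo (0:ℝ) 1, DifferentiableAt ℝ (fracIntL α f) x ∧
        DifferentiableAt ℝ (deriv (fracIntL α f)) x) →
      IntervalIntegrable (deriv (deriv (fracIntL α f))) volume 0 1 →
      ∀ x ∈ Icc (0:ℝ) 1, f x = c * ∫ z in Ioo (0:ℝ) 1,
        posPow (α - 1) (x - z) * deriv (deriv (fracIntL α f)) z := by
  obtain ⟨B₀, hB₀, h₀⟩ := exists_posPow_comp (p := 0) (q := 0) (by norm_num) (by norm_num)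
  obtain ⟨B₁, hB₁, h₁⟩ := exists_posPow_comp (p := α - 2) (q := 1 - α) (by linarith) (by linarith)
  obtain ⟨B₂, hB₂, h₂⟩ := exists_posPow_comp (p := α - 2) (q := 1) (by linarith) (by norm_num)
  obtain ⟨B₃, hB₃, h₃⟩ := exists_posPow_comp (p := 0) (q := α - 1) (by norm_num) (by linarith)
  simp only [show (0:ℝ) + 0 + 1 = 1 by ring] at h₀
  simp only [show α - 2 + (1 - α) + 1 = 0 by ring] at h₁
  simp only [show α - 2 + 1 + 1 = α by ring] at h₂
  simp only [show 0 + (α - 1) + 1 = α by ring] at h₃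
  have hΓ : 0 < Real.Gamma (2 - α) := Real.Gamma_pos_of_pos (by linarith)
  set c₀ := 1 / Real.Gamma (2 - α) with hc₀
  have hc₀pos : 0 < c₀ := by positivity
  refine ⟨B₀ * B₂ / (B₃ * (c₀ * B₁)), ?_⟩
  intro f f' hf hf' hf0 hd hg
  set g := deriv (deriv (fracIntL α f)) with hgdef
  set ν : Measure ℝ := volume.restrict (Ioo (0:ℝ) 1) with hν
  have hfc : ContinuousOn f (Icc 0 1) := fun x hx => (hf x hx).continuousWithinAt
  have hgν : Integrable g ν := (intervalIntegrable_iff_integrableOn_Ioo_of_le zero_le_one).1 hg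
  have hfν : Integrable f ν :=
    (hfc.integrableOn_compact isCompact_Icc).mono_set Ioo_subset_Icc_self
  have hzero : ∀ (r : ℝ) (u : ℝ → ℝ), ∀ t ≤ 0, ∫ z, posPow r (t - z) * u z ∂ν = 0 := by
    intro r u t ht
    rw [hν]
    refine setIntegral_eq_zero_of_forall_eq_zero fun z hz => ?_
    rw [posPow_of_nonpos _ (by linarith [hz.1]), zero_mul]
  set W : ℝ → ℝ := fun x => ∫ z, posPow (α - 1) (x - z) * g z ∂ν with hW
  have hWc : ContinuousOn W (Icc 0 1) :=
    continuousOn_integral_posPow (by linarith) hgν (ae_nonneg_restrict_Ioo g)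
  have hF : ∀ t < 1, c₀ * ∫ z, posPow (1 - α) (t - z) * f z ∂ν =
      B₀ * ∫ z, posPow 1 (t - z) * g z ∂ν := by
    intro t ht
    rcases le_or_gt t 0 with h | h
    · rw [hzero _ _ t h, hzero _ _ t h]; simp
    · have htI : t ∈ Icc (0:ℝ) 1 := ⟨h.le, ht.le⟩
      have e1 := fracIntL_eq_integral_integral hα₂ hf hf' hf0 hd hg ⟨h, ht⟩
      rw [hν, setIntegral_posPow_mul _ _ htI, ← hν]
      have e2 := (posPow_comp_potential h₀ hgν.aestronglyMeasurable (x := t)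
        (integrable_posPow_mul zero_le_one ht.le hgν (ae_nonneg_restrict_Ioo g))).2
      rw [integral_posPow_zero_mul (hzero 0 g) htI] at e2
      rw [← e2]
      refine Eq.trans e1 (integral_congr fun s hs => ?_)
      rw [uIcc_of_le h.le] at hs
      rw [hν, setIntegral_posPow_mul _ _ ⟨hs.1, hs.2.trans ht.le⟩]
      simp [hgdef]
  have hprim : ∀ x ∈ Ioo (0:ℝ) 1, c₀ * B₁ * B₃ * (∫ t in (0:ℝ)..x, f t) =
      B₀ * B₂ * ∫ t in (0:ℝ)..x, W t := by
    intro x hx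
    have hxI := Ioo_subset_Icc_self hx
    have e1 := (posPow_comp_potential h₁ hfν.aestronglyMeasurable (x := x)
      (integrable_posPow_mul le_rfl hxI.2 hfν (ae_nonneg_restrict_Ioo f))).2
    have e2 := (posPow_comp_potential h₂ hgν.aestronglyMeasurable (x := x)
      (integrable_posPow_mul (by linarith) hxI.2 hgν (ae_nonneg_restrict_Ioo g))).2
    have e3 := (posPow_comp_potential h₃ hgν.aestronglyMeasurable (x := x)
      (integrable_posPow_mul (by linarith) hxI.2 hgν (ae_nonneg_restrict_Ioo g))).2
    rw [integral_posPow_zero_mul (hzero _ g) hxI] at e3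
    have e4 : ∫ z, posPow 0 (x - z) * f z ∂ν = ∫ t in (0:ℝ)..x, f t := by
      rw [hν, setIntegral_posPow_mul _ _ hxI]; simp
    have e5 : c₀ * ∫ t, posPow (α - 2) (x - t) * ∫ z, posPow (1 - α) (t - z) * f z ∂ν =
        B₀ * ∫ t, posPow (α - 2) (x - t) * ∫ z, posPow 1 (t - z) * g z ∂ν := by
      rw [← MeasureTheory.integral_const_mul, ← MeasureTheory.integral_const_mul]
      congr 1; ext t
      rcases lt_or_ge t x with h | h
      · rw [mul_left_comm, hF t (h.trans hx.2)]; ring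
      · rw [posPow_of_nonpos _ (by linarith)]; simp
    rw [e1, e2, e4] at e5
    change ∫ t in (0:ℝ)..x, W t = _ at e3
    rw [e3]
    linear_combination B₃ * e5
  have hjoint : EqOn (fun x => c₀ * B₁ * B₃ * f x) (fun x => B₀ * B₂ * W x) (Ioo 0 1) := by
    intro x hx
    have d1 := (hasDerivAt_integral_of_continuousOn hfc hx).const_mul (c₀ * B₁ * B₃)
    have d2 := (hasDerivAt_integral_of_continuousOn hWc hx).const_mul (B₀ * B₂)
    refine d1.unique (d2.congr_of_eventuallyEq ?_)
    filter_upwards [isOpen_Ioo.mem_nhds hx] with y hy using hprim y hy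
  have hall := hjoint.of_subset_closure (continuousOn_const.mul hfc) (continuousOn_const.mul hWc)
    Ioo_subset_Icc_self (by rw [closure_Ioo zero_ne_one])
  intro x hx
  have := hall hx
  simp only at this
  rw [div_mul_eq_mul_div, eq_div_iff (by positivity)]
  linarith

/-- Integration against a charge with a density on `S` and point masses on `Y`. -/
lemma integral_mul_mixed_charge {S : Set ℝ} (hS : MeasurableSet S) (Y : Finset ℝ)
    (u d ψ : ℝ → ℝ) (h : IntegrableOn (fun z => ψ z * u z) S) :
    Integrable (fun z => ψ z * if z ∈ Y then d z else S.indicator u z)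
      (volume.restrict S + ∑ y ∈ Y, Measure.dirac y) ∧
    ∫ z, (ψ z * if z ∈ Y then d z else S.indicator u z)
      ∂(volume.restrict S + ∑ y ∈ Y, Measure.dirac y) =
      (∫ z in S, ψ z * u z) + ∑ y ∈ Y, ψ y * d y := by
  have hae : (fun z => ψ z * u z) =ᵐ[volume.restrict S]
      fun z => ψ z * if z ∈ Y then d z else S.indicator u z := by
    have h0 : ∀ᵐ z : ℝ, z ∉ (Y : Set ℝ) :=
      measure_eq_zero_iff_ae_notMem.1 (Y.finite_toSet.measure_zero volume)
    filter_upwards [ae_restrict_of_ae h0, ae_restrict_mem hS] with z hz hzS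
    rw [if_neg (by simpa using hz), indicator_of_mem hzS]
  have i1 := Integrable.congr h hae
  have i2 : ∀ y ∈ Y, Integrable (fun z => ψ z * if z ∈ Y then d z else S.indicator u z)
      (Measure.dirac y) := fun y _ => integrable_dirac enorm_lt_top
  have i3 := integrable_finsetSum_measure.2 i2
  refine ⟨i1.add_measure i3, ?_⟩
  rw [integral_add_measure i1 i3, integral_finsetSum_measure i2, ← integral_congr_ae hae]
  congr 1
  refine Finset.sum_congr rfl fun y hy => ?_
  rw [integral_dirac, if_pos hy]

lemma fillDist_spec {X : Finset ℝ} (hX : X.Nonempty) (hX01 : ↑X ⊆ Ioo (0:ℝ) 1) :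
    0 < fillDist X ∧ ∀ x ∈ Icc (0:ℝ) 1, ∃ y ∈ X, |x - y| ≤ fillDist X := by
  have : Nonempty X := hX.to_subtype
  have hex : ∀ x ∈ Icc (0:ℝ) 1, ∃ y ∈ X, |x - y| ≤ fillDist X := by
    intro x hx
    obtain ⟨j, hj⟩ := exists_eq_ciInf_of_finite (f := fun j : X => |x - (j : ℝ)|)
    refine ⟨j, j.2, ?_⟩
    rw [hj]
    refine le_ciSup (f := fun x : Icc (0:ℝ) 1 => ⨅ j : X, |(x : ℝ) - (j : ℝ)|) ?_ ⟨x, hx⟩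
    refine ⟨1, ?_⟩
    rintro _ ⟨w, rfl⟩
    have hj01 := hX01 j.2
    refine (ciInf_le (Finite.bddBelow_range _) j).trans (abs_le.2 ⟨?_, ?_⟩)
    · linarith [w.2.1, hj01.2]
    · linarith [w.2.2, hj01.1]
  refine ⟨?_, hex⟩
  obtain ⟨y, hy, hle⟩ := hex 0 (by simp)
  exact lt_of_lt_of_le (abs_pos.2 (by linarith [(hX01 hy).1])) hle

lemma rlGreen_eq_posPow {α x z : ℝ} (hα₁ : 1 < α) (hx : x ∈ Icc (0:ℝ) 1) (hz : z ∈ Ioo (0:ℝ) 1) :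
    rlGreen α x z = (1 / Real.Gamma α) *
      (posPow (α - 1) x * (1 - z) ^ (α - 1) - posPow (α - 1) (x - z)) := by
  have hb : α - 1 ≠ 0 := by linarith
  have hnn : ∀ s : ℝ, 0 ≤ s → posPow (α - 1) s = s ^ (α - 1) := by
    intro s hs
    rcases hs.eq_or_lt with h | h
    · rw [← h, posPow_of_nonpos _ le_rfl, Real.zero_rpow hb]
    · exact posPow_of_pos _ h
  unfold rlGreen
  split_ifs with h
  · rw [hnn x hx.1, hnn _ (sub_nonneg.2 h), Real.mul_rpow hx.1 (by linarith [hz.2])]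
  · rw [hnn x hx.1, posPow_of_nonpos _ (by linarith), sub_zero]

/-- `L²` stability of the potential of a neutral charge that vanishes on a set of sampling points
carrying the singular part of the charge. -/
lemma exists_mixed_charge_bound {a : ℝ} (ha0 : 1 / 2 < a) (ha1 : a < 1) :
    ∃ K : ℝ, 0 ≤ K ∧ ∀ (Y : Finset ℝ) (u d E : ℝ → ℝ) (h : ℝ), ↑Y ⊆ Icc (0:ℝ) 1 → 0 < h →
      AEStronglyMeasurable u (volume.restrict (Ioo 0 1)) →
      IntegrableOn (fun z => u z ^ 2) (Ioo 0 1) →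
      (∫ z in Ioo (0:ℝ) 1, u z) + ∑ y ∈ Y, d y = 0 →
      (∀ x ∈ Icc (0:ℝ) 1, E x = (∫ z in Ioo (0:ℝ) 1, posPow (2 * a - 1) (x - z) * u z) +
        ∑ y ∈ Y, posPow (2 * a - 1) (x - y) * d y) →
      (∀ y ∈ Y, E y = 0) →
      (∀ x ∈ Ioo (0:ℝ) 1, ∃ y ∈ Y, |x - y| ≤ h) →
      √(∫ x in Ioo (0:ℝ) 1, E x ^ 2) ≤ K * h ^ (2 * a) * √(∫ x in Ioo (0:ℝ) 1, u x ^ 2) := by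
  obtain ⟨B, hB, hcomp⟩ :=
    exists_posPow_comp (p := a - 1) (q := a - 1) (by linarith) (by linarith)
  simp only [show a - 1 + (a - 1) + 1 = 2 * a - 1 by ring] at hcomp
  obtain ⟨C, hC, henergy⟩ := exists_energy_identity ha0 ha1
  obtain ⟨K, hK, hsamp⟩ := exists_sampling_bound ha0 ha1
  refine ⟨K * C / B ^ 2, by positivity, ?_⟩
  intro Y u d E h hY hh hum hu2 hneutral hE hEY hsep
  have huL2 : MemLp u 2 (volume.restrict (Ioo 0 1)) := (memLp_two_iff_integrable_sq hum).2 hu2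
  have hu : IntegrableOn u (Ioo 0 1) := huL2.integrable one_le_two
  set μ : Measure ℝ := volume.restrict (Ioo (0:ℝ) 1) + ∑ y ∈ Y, Measure.dirac y with hμ
  set ρ : ℝ → ℝ := fun z => if z ∈ Y then d z else (Ioo (0:ℝ) 1).indicator u z with hρ
  have hone := integral_mul_mixed_charge measurableSet_Ioo Y u d (fun _ => 1)
    (by simpa using hu)
  simp only [one_mul] at hone
  have hρi : Integrable ρ μ := hone.1
  have hρ0 : ∀ z, z ∉ Icc (0:ℝ) 1 → ρ z = 0 := by
    intro z hz
    simp only [hρ]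
    rw [if_neg fun hzY : z ∈ Y => hz (hY hzY),
      indicator_of_notMem fun hz' => hz (Ioo_subset_Icc_self hz')]
  have hρint : ∫ z, ρ z ∂μ = 0 := hone.2.trans hneutral
  have hneg : ∀ᵐ z ∂μ, z < 0 → ρ z = 0 :=
    Filter.Eventually.of_forall fun z hz => hρ0 z fun hz' => by linarith [hz'.1]
  have hEμ : ∀ x ∈ Icc (0:ℝ) 1, ∫ z, posPow (2 * a - 1) (x - z) * ρ z ∂μ = E x := by
    intro x hx
    rw [hE x hx]
    exact (integral_mul_mixed_charge measurableSet_Ioo Y u d _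
      (integrable_posPow_mul (by linarith) hx.2 hu (ae_nonneg_restrict_Ioo u))).2
  have hEc : ContinuousOn E (Icc 0 1) :=
    (continuousOn_integral_posPow (by linarith) hρi hneg).congr fun x hx => (hEμ x hx).symm
  have hE2 : IntegrableOn (fun x => E x ^ 2) (Ioo 0 1) :=
    ((hEc.pow 2).integrableOn_compact isCompact_Icc).mono_set Ioo_subset_Icc_self
  have hEm : AEStronglyMeasurable E (volume.restrict (Ioo 0 1)) :=
    ((hEc.mono Ioo_subset_Icc_self).aestronglyMeasurable measurableSet_Ioo)
  obtain ⟨hEu, hCS⟩ := sq_integral_mul_le hEm hum hE2 hu2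
  obtain ⟨hφ2, hφ⟩ := henergy μ ρ hρi hρ0 hρint
  have hpair : ∫ x, (∫ z, posPow (2 * a - 1) (x - z) * ρ z ∂μ) * ρ x ∂μ =
      ∫ x in Ioo (0:ℝ) 1, E x * u x := by
    have e := (integral_mul_mixed_charge measurableSet_Ioo Y u d E hEu).2
    have e0 : ∑ y ∈ Y, E y * d y = 0 :=
      Finset.sum_eq_zero fun y hy => by rw [hEY y hy, zero_mul]
    rw [e0, add_zero] at e
    rw [← e]
    refine integral_congr_ae (Filter.Eventually.of_forall fun x => ?_)
    change _ * ρ x = E x * ρ x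
    by_cases hx : x ∈ Icc (0:ℝ) 1
    · rw [hEμ x hx]
    · rw [hρ0 x hx, mul_zero, mul_zero]
  set φ : ℝ → ℝ := fun t => ∫ z, posPow (a - 1) (t - z) * ρ z ∂μ with hφdef
  have hφm : AEStronglyMeasurable φ volume := by
    refine AEStronglyMeasurable.integral_prod_right' (μ := volume) (ν := μ)
      (f := fun p : ℝ × ℝ => posPow (a - 1) (p.1 - p.2) * ρ p.2) ?_
    refine AEStronglyMeasurable.mul ?_ hρi.aestronglyMeasurable.comp_snd
    exact ((measurable_posPow _).comp (measurable_fst.sub measurable_snd)).aestronglyMeasurable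
  have key := hsamp φ (fun x => B * E x) h hh hφm hφ2 (fun x hx => by
      have := posPow_comp_potential hcomp hρi.aestronglyMeasurable (x := x)
        (integrable_posPow_mul (by linarith) hx.2 hρi hneg)
      rw [hEμ x hx] at this
      exact this)
    (by simpa only [mul_pow, IntegrableOn] using hE2.const_mul (B ^ 2))
    (fun x hx => by
      obtain ⟨y, hy, hxy⟩ := hsep x hx
      exact ⟨y, hY hy, hxy, by rw [hEY y hy, mul_zero]⟩)
  simp only [mul_pow] at key
  rw [MeasureTheory.integral_const_mul, hφ, hpair] at key
  set N := ∫ x in Ioo (0:ℝ) 1, E x ^ 2 with hN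
  set U := ∫ x in Ioo (0:ℝ) 1, u x ^ 2 with hU
  have hN0 : 0 ≤ N := integral_nonneg fun x => sq_nonneg _
  have hU0 : 0 ≤ U := integral_nonneg fun x => sq_nonneg _
  have hI : -(∫ x in Ioo (0:ℝ) 1, E x * u x) ≤ √N * √U := by
    rw [← Real.sqrt_mul hN0]
    exact (neg_le_abs _).trans (Real.abs_le_sqrt hCS)
  have hhp : 0 ≤ h ^ (2 * a) := Real.rpow_nonneg hh.le _
  have key2 : B ^ 2 * N ≤ K * h ^ (2 * a) * C * (√N * √U) := by
    calc B ^ 2 * N ≤ _ := key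
      _ = K * h ^ (2 * a) * C * -(∫ x in Ioo (0:ℝ) 1, E x * u x) := by ring
      _ ≤ _ := mul_le_mul_of_nonneg_left hI (by positivity)
  rcases (Real.sqrt_nonneg N).eq_or_lt with h0 | h0
  · rw [← h0]; positivity
  · have hNs : N = √N * √N := (Real.mul_self_sqrt hN0).symm
    have key3 : √N * (B ^ 2 * √N) ≤ √N * (K * h ^ (2 * a) * C * √U) := by
      calc √N * (B ^ 2 * √N) = B ^ 2 * N := by rw [hNs]; simp; ring
        _ ≤ _ := key2
        _ = _ := by ring
    have key4 := le_of_mul_le_mul_left key3 h0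
    rw [div_mul_eq_mul_div, div_mul_eq_mul_div, le_div_iff₀ (by positivity)]
    linarith

theorem stmt_13 (α : ℝ) (hα₁ : 1 < α) (hα₂ : α < 2) :
    ∃ C₃ > (0:ℝ), ∃ h₀ > (0:ℝ),
      ∀ X : Finset ℝ, X.Nonempty → ↑X ⊆ Set.Ioo (0:ℝ) 1 →
        fillDist X ≤ h₀ →
        -- `f ∈ C¹([0,1])` with derivative `f'`, `f(0) = f(1) = 0`, `f'(0) = 0`:
        ∀ f f' : ℝ → ℝ,
          (∀ x ∈ Set.Icc (0:ℝ) 1, HasDerivWithinAt f (f' x) (Set.Icc 0 1) x) →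
          ContinuousOn f' (Set.Icc 0 1) →
          f 0 = 0 → f 1 = 0 → f' 0 = 0 →
          -- `₀D_x^α f` exists on `(0,1)` and lies in `L²(0,1)`:
          (∀ x ∈ Set.Ioo (0:ℝ) 1,
            DifferentiableAt ℝ (fracIntL α f) x ∧
            DifferentiableAt ℝ (deriv (fracIntL α f)) x) →
          IntervalIntegrable (fun x => (deriv (deriv (fracIntL α f)) x) ^ 2)
            volume 0 1 →
          -- kernel interpolant `s(x) = Σ_j c_j G(x, x_j)` with `s = f` on `X`:
          ∀ c : ℝ → ℝ,
            (∀ i ∈ X, ∑ j ∈ X, c j * rlGreen α i j = f i) →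
            Real.sqrt (∫ x in Set.Ioo (0:ℝ) 1,
                (f x - ∑ j ∈ X, c j * rlGreen α x j) ^ 2)
              ≤ C₃ * fillDist X ^ α *
                Real.sqrt (∫ x in Set.Ioo (0:ℝ) 1,
                  (deriv (deriv (fracIntL α f)) x) ^ 2) := by
  obtain ⟨k, hrepr⟩ := exists_eq_fractional_integral hα₁ hα₂
  obtain ⟨K, hK, hbound⟩ :=
    exists_mixed_charge_bound (a := α / 2) (by linarith) (by linarith)
  simp only [show 2 * (α / 2) = α by ring] at hbound
  refine ⟨K * |k| + 1, by positivity, 1, one_pos, ?_⟩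
  intro X hX hX01 _ f f' hf hf' hf0 hf1 _ hd hg2 c hc
  obtain ⟨hh, hsep⟩ := fillDist_spec hX hX01
  set g := deriv (deriv (fracIntL α f)) with hgdef
  have hgm : Measurable g := measurable_deriv _
  have hg2' : IntegrableOn (fun x => g x ^ 2) (Ioo 0 1) :=
    (intervalIntegrable_iff_integrableOn_Ioo_of_le zero_le_one).1 hg2
  have hgi : IntegrableOn g (Ioo 0 1) :=
    ((memLp_two_iff_integrable_sq hgm.aestronglyMeasurable).2 hg2').integrable one_le_two
  have hfg := hrepr f f' hf hf' hf0 hd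
    ((intervalIntegrable_iff_integrableOn_Ioo_of_le zero_le_one).2 hgi)
  have h0X : (0:ℝ) ∉ X := fun h => (hX01 h).1.false
  have h1X : (1:ℝ) ∉ X := fun h => (hX01 h).2.false
  have h01X : (0:ℝ) ∉ insert 1 X := by simp [h0X]
  set Γ := Real.Gamma α with hΓ
  -- point masses at the end points that reproduce the kernel and make the charge neutral
  set d₀ : ℝ := -∑ j ∈ X, c j * ((1 / Γ) * (1 - j) ^ (α - 1)) with hd₀
  set d₁ : ℝ := -((∫ z in Ioo (0:ℝ) 1, k * g z) + ∑ j ∈ X, c j * (1 / Γ) + d₀) with hd₁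
  set d : ℝ → ℝ := fun z => if z = 0 then d₀ else if z = 1 then d₁ else c z * (1 / Γ) with hddef
  have hsum : ∀ ψ : ℝ → ℝ, ∑ y ∈ insert 0 (insert 1 X), ψ y * d y =
      ψ 0 * d₀ + (ψ 1 * d₁ + ∑ j ∈ X, ψ j * (c j * (1 / Γ))) := by
    intro ψ
    rw [Finset.sum_insert h01X, Finset.sum_insert h1X]
    congr 1
    · simp [hddef]
    · congr 1
      · simp [hddef]
      · refine Finset.sum_congr rfl fun j hj => ?_
        simp only [hddef]
        rw [if_neg (ne_of_mem_of_not_mem hj h0X), if_neg (ne_of_mem_of_not_mem hj h1X)]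
  have hres : ∀ x ∈ Icc (0:ℝ) 1, f x - ∑ j ∈ X, c j * rlGreen α x j =
      (∫ z in Ioo (0:ℝ) 1, posPow (α - 1) (x - z) * (k * g z)) +
        ∑ y ∈ insert 0 (insert 1 X), posPow (α - 1) (x - y) * d y := by
    intro x hx
    rw [hsum fun y => posPow (α - 1) (x - y), hfg x hx,
      posPow_of_nonpos (s := x - 1) _ (by linarith [hx.2]), ← MeasureTheory.integral_const_mul, hd₀,
      sub_zero, zero_mul, zero_add, mul_neg,
      Finset.mul_sum, neg_add_eq_sub, ← Finset.sum_sub_distrib, sub_eq_add_neg,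
      ← Finset.sum_neg_distrib]
    congr 1
    · congr 1; ext z; ring
    · refine Finset.sum_congr rfl fun j hj => ?_
      rw [rlGreen_eq_posPow hα₁ hx (hX01 hj)]
      ring
  have hzero0 : ∑ j ∈ X, c j * rlGreen α 0 j = 0 := by
    refine Finset.sum_eq_zero fun j hj => ?_
    rw [rlGreen_eq_posPow hα₁ (by simp) (hX01 hj), posPow_of_nonpos _ le_rfl,
      posPow_of_nonpos _ (by linarith [(hX01 hj).1])]
    simp
  have hzero1 : ∑ j ∈ X, c j * rlGreen α 1 j = 0 := by
    refine Finset.sum_eq_zero fun j hj => ?_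
    rw [rlGreen_eq_posPow hα₁ (by simp) (hX01 hj), posPow_of_pos _ one_pos,
      posPow_of_pos _ (by linarith [(hX01 hj).2])]
    simp
  have main := hbound (insert 0 (insert 1 X)) (fun z => k * g z) d
    (fun x => f x - ∑ j ∈ X, c j * rlGreen α x j) (fillDist X) ?_ hh
    (hgm.const_mul k).aestronglyMeasurable ?_ ?_ hres ?_ ?_
  · simp only [mul_pow] at main
    rw [MeasureTheory.integral_const_mul, Real.sqrt_mul (sq_nonneg k), Real.sqrt_sq_eq_abs] at main
    refine main.trans ?_
    have hp := Real.rpow_nonneg hh.le α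
    have hs := Real.sqrt_nonneg (∫ x in Ioo (0:ℝ) 1, g x ^ 2)
    nlinarith [mul_nonneg hp hs]
  · intro y hy
    simp only [Finset.coe_insert, mem_insert_iff, Finset.mem_coe] at hy
    rcases hy with rfl | rfl | hy
    · simp
    · simp
    · exact Ioo_subset_Icc_self (hX01 hy)
  · simpa only [mul_pow, IntegrableOn] using hg2'.const_mul (k ^ 2)
  · have := hsum fun _ => 1
    simp only [one_mul] at this
    rw [this, hd₁]
    ring
  · intro y hy
    simp only [Finset.mem_insert] at hy
    rcases hy with rfl | rfl | hy
    · simp only [hzero0, hf0, sub_zero]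
    · simp only [hzero1, hf1, sub_zero]
    · simp only [hc y hy, sub_self]
  · intro x hx
    obtain ⟨y, hy, hxy⟩ := hsep x (Ioo_subset_Icc_self hx)
    exact ⟨y, by simp [hy], hxy⟩
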